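/- arXiv:1505.08110 — 2 statements merged into one kernel-verified Lean document; each statement's English description precedes it below -/
import Mathlib

section
/- Let p be a prime, G a finite group of characteristic p, and V a normal p-subgroup of G. Let X be the set of all elements x ∈ C_G(V) such that [O_p(G), x] ≤ V, i.e., u⁻¹·u^x ∈ V for every u ∈ O_p(G). Then X is a subgroup of G, X is normal in G, and X is a p-group. -/
/-- The `p`-core `O_p(G)`: the largest normal `p`-subgroup of `G`. -/
def pCore (p : ℕ) (G : Type*) [Group G] : Subgroup G :=
  sSup {H : Subgroup G | H.Normal ∧ IsPGroup p H}

/-- A group `G` is of characteristic `p` if `C_G(O_p(G)) ≤ O_p(G)`. -/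
def IsCharacteristicP (p : ℕ) (G : Type*) [Group G] : Prop :=
  Subgroup.centralizer ((pCore p G : Subgroup G) : Set G) ≤ pCore p G

theorem pCore_normal (p : ℕ) (G : Type*) [Group G] : (pCore p G).Normal :=
  Subgroup.sSup_normal _ fun _ h => h.1

theorem isPGroup_pCore (p : ℕ) (G : Type*) [Group G] [Finite G] : IsPGroup p (pCore p G) :=
  Sylow.sSup_of_normal _ (fun _ h => h.2) fun _ h => h.1

/-- The subgroup of elements of `C_G(V)` that centralize `Q` modulo `V`. -/
def centralizerModulo {G : Type*} [Group G] (Q V : Subgroup G) : Subgroup G where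
  carrier := {x : G | x ∈ Subgroup.centralizer (V : Set G) ∧
    ∀ u ∈ Q, u⁻¹ * (x⁻¹ * u * x) ∈ V}
  one_mem' := ⟨one_mem _, fun u _ => by simp⟩
  mul_mem' := by
    rintro x y ⟨hx, hxu⟩ ⟨hy, hyu⟩
    refine ⟨mul_mem hx hy, fun u hu => ?_⟩
    have hcomm := Subgroup.mem_centralizer_iff.mp hy _ (hxu u hu)
    have key : u⁻¹ * ((x * y)⁻¹ * u * (x * y)) =
        u⁻¹ * (y⁻¹ * u * y) * (u⁻¹ * (x⁻¹ * u * x)) := by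
      calc u⁻¹ * ((x * y)⁻¹ * u * (x * y))
          = u⁻¹ * y⁻¹ * u * (u⁻¹ * (x⁻¹ * u * x) * y) := by group
        _ = u⁻¹ * (y⁻¹ * u * y) * (u⁻¹ * (x⁻¹ * u * x)) := by rw [hcomm]; group
    rw [key]
    exact mul_mem (hyu u hu) (hxu u hu)
  inv_mem' := by
    rintro x ⟨hx, hxu⟩
    refine ⟨inv_mem hx, fun u hu => ?_⟩
    have hcomm := Subgroup.mem_centralizer_iff.mp hx _ (inv_mem (hxu u hu))
    have key : u⁻¹ * (x⁻¹⁻¹ * u * x⁻¹) = (u⁻¹ * (x⁻¹ * u * x))⁻¹ := by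
      calc u⁻¹ * (x⁻¹⁻¹ * u * x⁻¹)
          = u⁻¹ * (x * (u * (u⁻¹ * (x⁻¹ * u * x))) * x⁻¹) *
              (x * (u⁻¹ * (x⁻¹ * u * x))⁻¹) * x⁻¹ := by group
        _ = (u⁻¹ * (x⁻¹ * u * x))⁻¹ := by rw [← hcomm]; group
    rw [key]
    exact inv_mem (hxu u hu)

theorem centralizerModulo_normal {G : Type*} [Group G] (Q V : Subgroup G)
    [hQ : Q.Normal] [hV : V.Normal] : (centralizerModulo Q V).Normal where
  conj_mem := by
    rintro x ⟨hx, hxu⟩ g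
    refine ⟨Subgroup.normal_centralizer.conj_mem x hx g, fun u hu => ?_⟩
    convert hV.conj_mem _ (hxu _ (hQ.conj_mem u hu g⁻¹)) g using 1
    group

theorem conj_pow_eq_mul_pow {G : Type*} [Group G] {x u v : G} (hv : Commute v x)
    (h : x⁻¹ * u * x = u * v) (n : ℕ) : (x ^ n)⁻¹ * u * x ^ n = u * v ^ n := by
  induction n with
  | zero => simp
  | succ n ih =>
    calc (x ^ (n + 1))⁻¹ * u * x ^ (n + 1)
        = x⁻¹ * ((x ^ n)⁻¹ * u * x ^ n) * x := by rw [pow_succ]; group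
      _ = x⁻¹ * u * (v ^ n * x) := by rw [ih]; group
      _ = x⁻¹ * u * x * v ^ n := by rw [(hv.pow_left n).eq]; group
      _ = u * v ^ (n + 1) := by rw [h, pow_succ', mul_assoc]

theorem pow_card_mem_centralizer {G : Type*} [Group G] {Q V : Subgroup G} {x : G}
    (hx : x ∈ centralizerModulo Q V) :
    x ^ Nat.card V ∈ Subgroup.centralizer (Q : Set G) := by
  refine Subgroup.mem_centralizer_iff.mpr fun u hu => ?_
  have hv := hx.2 u hu
  have hpow := congrArg Subtype.val (pow_card_eq_one' (x := (⟨_, hv⟩ : V)))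
  rw [Subgroup.coe_pow, Subgroup.coe_one] at hpow
  have h := conj_pow_eq_mul_pow (Subgroup.mem_centralizer_iff.mp hx.1 _ hv)
    (mul_inv_cancel_left u _).symm (Nat.card V)
  rw [hpow, mul_one, mul_assoc, inv_mul_eq_iff_eq_mul] at h
  exact h

/-- Lemma 2.7(c): if `G` is a finite group of characteristic `p` and `V` is a normal
`p`-subgroup of `G`, then the set `X` of elements `x ∈ C_G(V)` with `[O_p(G), x] ≤ V`
is a normal `p`-subgroup of `G`. -/
theorem normal_pSubgroup_of_centralizer {p : ℕ} (hp : p.Prime) {G : Type*} [Group G] [Finite G]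
    (hG : IsCharacteristicP p G) (V : Subgroup G) (hVn : V.Normal) (hVp : IsPGroup p V) :
    ∃ X : Subgroup G,
      ((X : Set G) = {x : G | x ∈ Subgroup.centralizer (V : Set G) ∧
        ∀ u ∈ pCore p G, u⁻¹ * (x⁻¹ * u * x) ∈ V}) ∧ X.Normal ∧ IsPGroup p X := by
  have := Fact.mk hp
  have := pCore_normal p G
  refine ⟨centralizerModulo (pCore p G) V, rfl, centralizerModulo_normal _ _, ?_⟩
  obtain ⟨k, hk⟩ := IsPGroup.iff_card.mp hVp
  rintro ⟨x, hx⟩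
  obtain ⟨m, hm⟩ := isPGroup_pCore p G ⟨_, hG (pow_card_mem_centralizer hx)⟩
  refine ⟨k + m, Subtype.ext ?_⟩
  simpa [hk, ← pow_mul, ← pow_add] using congrArg Subtype.val hm
end

section
/- Let p be a prime, M a finite group, Q a normal p-subgroup of M, and Θ a normal subgroup of M whose order is coprime to p, such that Θ ≤ C_M(Q) and the quotient C_M(Q)/Θ is a p-group. Then the quotient group M/Θ is of characteristic p, i.e., C_{M/Θ}(O_p(M/Θ)) ≤ O_p(M/Θ). -/
/-- A normal `p`-subgroup is contained in the `p`-core. -/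
theorem IsPGroup.le_pCore {p : ℕ} {G : Type*} [Group G] {H : Subgroup G} (hH : IsPGroup p H)
    (hn : H.Normal) : H ≤ pCore p G :=
  le_sSup ⟨hn, hH⟩

/-- If `Q` and `Θ` are normal subgroups intersecting trivially, an element centralizing `Q`
modulo `Θ` centralizes `Q`. -/
theorem Subgroup.mem_centralizer_of_commute_mk {G : Type*} [Group G] {Q Θ : Subgroup G}
    [Θ.Normal] (hQ : Q.Normal) (hdisj : Disjoint Q Θ) {x : G}
    (hx : ∀ q ∈ Q, Commute (q : G ⧸ Θ) (x : G ⧸ Θ)) :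
    x ∈ Subgroup.centralizer (Q : Set G) := by
  rw [Subgroup.mem_centralizer_iff]
  intro q hq
  have hmemQ : (q * x)⁻¹ * (x * q) ∈ Q := by
    have h := Q.mul_mem (hQ.conj_mem _ (Q.inv_mem hq) x⁻¹) hq
    simpa [mul_assoc] using h
  have hmemΘ : (q * x)⁻¹ * (x * q) ∈ Θ :=
    QuotientGroup.eq.mp (hx q hq)
  exact inv_mul_eq_one.mp (Subgroup.disjoint_def.mp hdisj hmemQ hmemΘ)

/-- The group-theoretic core of Proposition 2.9: if `Q` is a normal `p`-subgroup of the
finite group `M`, and `Θ` is a normal subgroup of order coprime to `p` with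
`Θ ≤ C_M(Q)` and `C_M(Q)/Θ` a `p`-group, then `M/Θ` is of characteristic `p`. -/
theorem quotient_isCharacteristicP {p : ℕ} (hp : p.Prime) {M : Type*} [Group M] [Finite M]
    (Q : Subgroup M) (hQn : Q.Normal) (hQp : IsPGroup p Q)
    (Θ : Subgroup M) [hΘn : Θ.Normal]
    (hcop : Nat.Coprime (Nat.card Θ) p)
    (hΘC : Θ ≤ Subgroup.centralizer (Q : Set M))
    (hquot : ∀ x ∈ Subgroup.centralizer (Q : Set M), ∃ n : ℕ, x ^ p ^ n ∈ Θ) :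
    IsCharacteristicP p (M ⧸ Θ) := by
  have hdisj : Disjoint Q Θ :=
    hQp.disjoint_of_coprime IsPGroup.card hcop.symm
  have hQ_le : Q.map (QuotientGroup.mk' Θ) ≤ pCore p (M ⧸ Θ) :=
    (hQp.map _).le_pCore (hQn.map _ (QuotientGroup.mk'_surjective Θ))
  have hC_le : (Subgroup.centralizer (Q : Set M)).map (QuotientGroup.mk' Θ) ≤
      pCore p (M ⧸ Θ) := by
    refine IsPGroup.le_pCore ?_ (Subgroup.Normal.map inferInstance _
      (QuotientGroup.mk'_surjective Θ))
    rw [isPGroup_iff_pow_pow_eq_one]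
    rintro ⟨_, x, hx, rfl⟩
    obtain ⟨n, hn⟩ := hquot x hx
    exact ⟨n, Subtype.ext ((QuotientGroup.eq_one_iff (x ^ p ^ n)).mpr hn)⟩
  intro y hy
  obtain ⟨x, rfl⟩ := QuotientGroup.mk'_surjective Θ y
  refine hC_le (Subgroup.mem_map_of_mem _
    (Subgroup.mem_centralizer_of_commute_mk hQn hdisj fun q hq => ?_))
  exact Subgroup.mem_centralizer_iff.mp hy _ (hQ_le (Subgroup.mem_map_of_mem _ hq))
end
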